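/- Let n ≥ 2 and m ≥ 1 be integers, set λ := m/n, and let B be a random variable with the mixed binomial distribution Bin(m, 2P/n). Then for every real y ≥ 1 with λ·(y − 1) ≤ 1/2, the probability generating function of B satisfies g_B(y) ≤ exp( (13/12)·λ·(y−1) + (6/5)·λ²·(y−1)² ). -/

import Mathlib

open MeasureTheory

/-- The point of the interval `[min(u,v), max(u,v)]` closest to `1/2`. -/
noncomputable def cmid (u v : ℝ) : ℝ := min (max (min u v) (1 / 2)) (max u v)

/-- `P(u,v) = 1 − 2·c(u,v)·(1 − c(u,v))`, the random variable `P` as a function of the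
two uniform endpoint samples. -/
noncomputable def Pfun (u v : ℝ) : ℝ := 1 - 2 * cmid u v * (1 - cmid u v)

/-- `P[B = k]` for a random variable `B` with the mixed binomial distribution
`Bin(m, 2P/n)`: `P[B = k] = E[ binom(m,k)·(2P/n)^k·(1 − 2P/n)^{m−k} ]`. -/
noncomputable def mixedBinomPMF (n m k : ℕ) : ℝ :=
  ∫ u in (0 : ℝ)..1, ∫ v in (0 : ℝ)..1,
    (Nat.choose m k : ℝ) * (2 * Pfun u v / n) ^ k * (1 - 2 * Pfun u v / n) ^ (m - k)

/-- The probability generating function `g_B(y) = Σ_{k≥0} P[B = k]·y^k` of a random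
variable `B` with the mixed binomial distribution `Bin(m, 2P/n)`. -/
noncomputable def mixedBinomPGF (n m : ℕ) (y : ℝ) : ℝ :=
  ∑' k : ℕ, mixedBinomPMF n m k * y ^ k

lemma cont_cmid : Continuous (fun p : ℝ × ℝ => cmid p.1 p.2) := by
  unfold cmid; fun_prop

lemma cont_P : Continuous (fun p : ℝ × ℝ => Pfun p.1 p.2) := by
  have := cont_cmid
  unfold Pfun; fun_prop

lemma cont_inner (f : ℝ → ℝ) (hf : Continuous f) :
    Continuous (fun u => ∫ v in (0:ℝ)..1, f (Pfun u v)) := by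
  apply intervalIntegral.continuous_parametric_intervalIntegral_of_continuous'
  exact hf.comp cont_P

lemma cont_v (f : ℝ → ℝ) (hf : Continuous f) (u : ℝ) :
    Continuous (fun v => f (Pfun u v)) :=
  hf.comp (cont_P.comp (by fun_prop : Continuous (fun v : ℝ => (u, v))))

lemma pgf_eq (n m : ℕ) (y : ℝ) :
    mixedBinomPGF n m y = ∫ u in (0:ℝ)..1, ∫ v in (0:ℝ)..1,
      (1 + 2 * Pfun u v * (y - 1) / n) ^ m := by
  unfold mixedBinomPGF
  rw [tsum_eq_sum (s := Finset.range (m+1))]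
  · have h1 : ∀ k, mixedBinomPMF n m k * y ^ k = ∫ u in (0:ℝ)..1, ∫ v in (0:ℝ)..1,
        (fun p : ℝ => (Nat.choose m k : ℝ) * (2 * p / n) ^ k * (1 - 2 * p / n) ^ (m - k) * y ^ k)
          (Pfun u v) := by
      intro k
      unfold mixedBinomPMF
      simp only [intervalIntegral.integral_mul_const]
    have hc : ∀ k, Continuous (fun p : ℝ =>
        (Nat.choose m k : ℝ) * (2 * p / n) ^ k * (1 - 2 * p / n) ^ (m - k) * y ^ k) := by
      intro k; fun_prop
    rw [Finset.sum_congr rfl (fun k _ => h1 k)]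
    rw [← intervalIntegral.integral_finsetSum
      (fun k _ => (cont_inner _ (hc k)).intervalIntegrable _ _)]
    congr 1; ext u
    rw [← intervalIntegral.integral_finsetSum
      (fun k _ => (cont_v _ (hc k) u).intervalIntegrable _ _)]
    congr 1; ext v
    have : (1 + 2 * Pfun u v * (y - 1) / n) = (2 * Pfun u v / n) * y + (1 - 2 * Pfun u v / n) := by
      ring
    rw [this, add_pow]
    apply Finset.sum_congr rfl
    intro k _
    simp only [mul_pow]; ring
  · intro k hk
    have : m < k := by simpa using hk
    simp [mixedBinomPMF, Nat.choose_eq_zero_of_lt this]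

lemma D_eq (u v : ℝ) : 2 * Pfun u v - 1 = (1 - 2 * cmid u v) ^ 2 := by
  unfold Pfun; ring

lemma cmid_mem (u v : ℝ) (hu : u ∈ Set.Icc (0:ℝ) 1) (hv : v ∈ Set.Icc (0:ℝ) 1) :
    cmid u v ∈ Set.Icc (0:ℝ) 1 := by
  obtain ⟨a, b⟩ := hu
  obtain ⟨c, d⟩ := hv
  unfold cmid
  constructor
  · simp [a, c]
  · simp [b, d]

lemma integral_sq (a b : ℝ) : ∫ v in a..b, (1 - 2 * v) ^ 2 =
    ((1 - 2 * a) ^ 3 - (1 - 2 * b) ^ 3) / 6 := by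
  have : ∀ x ∈ Set.uIcc a b, HasDerivAt (fun v : ℝ => -(1 - 2 * v) ^ 3 / 6) ((1 - 2 * x) ^ 2) x := by
    intro x _
    have h := ((((hasDerivAt_id x).const_mul 2).const_sub 1).pow 3).neg.div_const 6
    refine HasDerivAt.congr_deriv h ?_
    simp only [id]; push_cast; ring
  rw [intervalIntegral.integral_eq_sub_of_hasDerivAt this
    (Continuous.intervalIntegrable (by fun_prop) _ _)]
  ring

lemma split3 (f : ℝ → ℝ) (hf : Continuous f) (a b : ℝ) :
    ∫ v in (0:ℝ)..1, f v = (∫ v in (0:ℝ)..a, f v) + (∫ v in a..b, f v) + ∫ v in b..1, f v := by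
  rw [intervalIntegral.integral_add_adjacent_intervals,
    intervalIntegral.integral_add_adjacent_intervals] <;> exact hf.intervalIntegrable _ _

lemma cont_D (u : ℝ) : Continuous (fun v => (1 - 2 * cmid u v) ^ 2) := by
  unfold cmid; fun_prop

lemma inner_lo (u : ℝ) (h0 : 0 ≤ u) (h1 : u ≤ 1 / 2) :
    ∫ v in (0:ℝ)..1, (1 - 2 * cmid u v) ^ 2 = u * (1 - 2 * u) ^ 2 + (1 - 2 * u) ^ 3 / 6 := by
  rw [split3 _ (cont_D u) u (1 / 2)]
  have e1 : ∫ v in (0:ℝ)..u, (1 - 2 * cmid u v) ^ 2 = ∫ v in (0:ℝ)..u, (1 - 2 * u) ^ 2 := by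
    apply intervalIntegral.integral_congr
    intro v hv
    rw [Set.uIcc_of_le h0] at hv
    have : cmid u v = u := by
      unfold cmid
      rw [min_eq_right hv.2, max_eq_left hv.2, max_eq_right (hv.2.trans h1), min_eq_right h1]
    simp only [this]
  have e2 : ∫ v in u..(1/2), (1 - 2 * cmid u v) ^ 2 = ∫ v in u..(1/2), (1 - 2 * v) ^ 2 := by
    apply intervalIntegral.integral_congr
    intro v hv
    rw [Set.uIcc_of_le h1] at hv
    have : cmid u v = v := by
      unfold cmid
      rw [min_eq_left hv.1, max_eq_right hv.1, max_eq_right h1, min_eq_right hv.2]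
    simp only [this]
  have e3 : ∫ v in (1/2:ℝ)..1, (1 - 2 * cmid u v) ^ 2 = ∫ v in (1/2:ℝ)..1, (0:ℝ) := by
    apply intervalIntegral.integral_congr
    intro v hv
    rw [Set.uIcc_of_le (by norm_num)] at hv
    have h2 := h1.trans hv.1
    have : cmid u v = 1 / 2 := by
      unfold cmid
      rw [min_eq_left h2, max_eq_right h2, max_eq_right h1, min_eq_left hv.1]
    simp only [this]; norm_num
  rw [e1, e2, e3, integral_sq]
  simp

lemma inner_hi (u : ℝ) (h0 : 1 / 2 ≤ u) (h1 : u ≤ 1) :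
    ∫ v in (0:ℝ)..1, (1 - 2 * cmid u v) ^ 2 =
      (1 - u) * (1 - 2 * u) ^ 2 - (1 - 2 * u) ^ 3 / 6 := by
  rw [split3 _ (cont_D u) (1 / 2) u]
  have e1 : ∫ v in u..1, (1 - 2 * cmid u v) ^ 2 = ∫ v in u..1, (1 - 2 * u) ^ 2 := by
    apply intervalIntegral.integral_congr
    intro v hv
    rw [Set.uIcc_of_le h1] at hv
    have : cmid u v = u := by
      unfold cmid
      rw [min_eq_left hv.1, max_eq_right hv.1, max_eq_left h0, min_eq_left hv.1]
    simp only [this]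
  have e2 : ∫ v in (1/2)..u, (1 - 2 * cmid u v) ^ 2 = ∫ v in (1/2)..u, (1 - 2 * v) ^ 2 := by
    apply intervalIntegral.integral_congr
    intro v hv
    rw [Set.uIcc_of_le h0] at hv
    have : cmid u v = v := by
      unfold cmid
      rw [min_eq_right hv.2, max_eq_left hv.2, max_eq_left hv.1, min_eq_left hv.2]
    simp only [this]
  have e3 : ∫ v in (0:ℝ)..(1/2), (1 - 2 * cmid u v) ^ 2 = ∫ v in (0:ℝ)..(1/2), (0:ℝ) := by
    apply intervalIntegral.integral_congr
    intro v hv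
    rw [Set.uIcc_of_le (by norm_num)] at hv
    have h2 := hv.2.trans h0
    have : cmid u v = 1 / 2 := by
      unfold cmid
      rw [min_eq_right h2, max_eq_left h2, max_eq_right hv.2, min_eq_left h0]
    simp only [this]; norm_num
  rw [e1, e2, e3, integral_sq]
  simp; ring

lemma integral_D : ∫ u in (0:ℝ)..1, ∫ v in (0:ℝ)..1, (2 * Pfun u v - 1) = 1 / 12 := by
  have hc := cont_inner (fun p => 2 * p - 1) (by fun_prop)
  simp only [D_eq] at hc ⊢
  rw [← intervalIntegral.integral_add_adjacent_intervals
    (hc.intervalIntegrable 0 (1/2)) (hc.intervalIntegrable (1/2) 1)]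
  have e1 : ∫ u in (0:ℝ)..(1/2), ∫ v in (0:ℝ)..1, (1 - 2 * cmid u v) ^ 2 = 1 / 24 := by
    rw [intervalIntegral.integral_congr (g := fun u => u * (1 - 2 * u) ^ 2 + (1 - 2 * u) ^ 3 / 6)]
    · have : ∀ x ∈ Set.uIcc (0:ℝ) (1/2), HasDerivAt
          (fun u : ℝ => (1 - 2 * u) ^ 4 / 24 - (1 - 2 * u) ^ 3 / 12)
          (x * (1 - 2 * x) ^ 2 + (1 - 2 * x) ^ 3 / 6 - 0) x := by
        intro x _
        have h := ((((hasDerivAt_id x).const_mul 2).const_sub 1).pow 4).div_const 24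
        have h' := ((((hasDerivAt_id x).const_mul 2).const_sub 1).pow 3).div_const 12
        refine HasDerivAt.congr_deriv (h.sub h') ?_
        simp only [id]; push_cast; ring
      simp only [sub_zero] at this
      rw [intervalIntegral.integral_eq_sub_of_hasDerivAt this
        (Continuous.intervalIntegrable (by fun_prop) _ _)]
      norm_num
    · intro u hu
      rw [Set.uIcc_of_le (by norm_num)] at hu
      exact inner_lo u hu.1 hu.2
  have e2 : ∫ u in (1/2:ℝ)..1, ∫ v in (0:ℝ)..1, (1 - 2 * cmid u v) ^ 2 = 1 / 24 := by
    rw [intervalIntegral.integral_congr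
      (g := fun u => (1 - u) * (1 - 2 * u) ^ 2 - (1 - 2 * u) ^ 3 / 6)]
    · have : ∀ x ∈ Set.uIcc (1/2:ℝ) 1, HasDerivAt
          (fun u : ℝ => -((1 - 2 * u) ^ 4 / 24) - (1 - 2 * u) ^ 3 / 12)
          ((1 - x) * (1 - 2 * x) ^ 2 - (1 - 2 * x) ^ 3 / 6) x := by
        intro x _
        have h := ((((hasDerivAt_id x).const_mul 2).const_sub 1).pow 4).div_const 24
        have h' := ((((hasDerivAt_id x).const_mul 2).const_sub 1).pow 3).div_const 12
        refine HasDerivAt.congr_deriv (h.neg.sub h') ?_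
        simp only [id]; push_cast; ring
      rw [intervalIntegral.integral_eq_sub_of_hasDerivAt this
        (Continuous.intervalIntegrable (by fun_prop) _ _)]
      norm_num
    · intro u hu
      rw [Set.uIcc_of_le (by norm_num)] at hu
      exact inner_hi u hu.1 hu.2
  rw [e1, e2]; norm_num

lemma pointwise (n m : ℕ) (hn : 2 ≤ n) (y t : ℝ) (ht : t = (m : ℝ) / n * (y - 1)) (hy : 1 ≤ y)
    (hs : t ≤ 1 / 2) (u v : ℝ) (hu : u ∈ Set.Icc (0:ℝ) 1) (hv : v ∈ Set.Icc (0:ℝ) 1) :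
    (1 + 2 * Pfun u v * (y - 1) / n) ^ m ≤
      Real.exp t * (1 + t ^ 2) + Real.exp t * t * (2 * Pfun u v - 1) := by
  have hc := cmid_mem u v hu hv
  have hD := D_eq u v
  set D := 2 * Pfun u v - 1 with hDd
  have hD0 : 0 ≤ D := by rw [hD]; positivity
  have hD1 : D ≤ 1 := by rw [hD]; nlinarith [hc.1, hc.2]
  have hP : 2 * Pfun u v = 1 + D := by rw [hDd]; ring
  have hy' : 0 ≤ y - 1 := by linarith
  have ht0 : 0 ≤ t := by rw [ht]; positivity
  rw [hP]
  have h1 : (1 + (1 + D) * (y - 1) / n) ^ m ≤ Real.exp ((1 + D) * (y - 1) / n) ^ m := by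
    apply pow_le_pow_left₀ (by positivity)
    rw [add_comm]; exact Real.add_one_le_exp _
  have h2 : Real.exp ((1 + D) * (y - 1) / n) ^ m = Real.exp t * Real.exp (t * D) := by
    rw [← Real.exp_nat_mul, ← Real.exp_add, ht]
    congr 1; ring
  have h3 : Real.exp (t * D) ≤ 1 + t * D + t ^ 2 := by
    have hx0 : 0 ≤ t * D := by positivity
    have hxt : t * D ≤ t := by nlinarith
    have := Real.abs_exp_sub_one_sub_id_le (x := t * D) (by rw [abs_of_nonneg hx0]; linarith)
    have := (abs_le.mp this).2
    nlinarith
  rw [h2] at h1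
  have := mul_le_mul_of_nonneg_left h3 (Real.exp_pos t).le
  linarith

/-- For integers `n ≥ 2`, `m ≥ 1`, `λ = m/n`, and `y ≥ 1` with `λ(y−1) ≤ 1/2`, the
probability generating function of `B ∼ Bin(m, 2P/n)` satisfies
`g_B(y) ≤ exp((13/12)λ(y−1) + (6/5)λ²(y−1)²)`. -/
theorem stmt_13 (n m : ℕ) (hn : 2 ≤ n) (hm : 1 ≤ m) (lam : ℝ)
    (hlam : lam = (m : ℝ) / n) (y : ℝ) (hy : 1 ≤ y) (hsmall : lam * (y - 1) ≤ 1 / 2) :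
    mixedBinomPGF n m y ≤
      Real.exp (13 / 12 * lam * (y - 1) + 6 / 5 * lam ^ 2 * (y - 1) ^ 2) := by
  set t := lam * (y - 1) with ht
  have ht' : t = (m : ℝ) / n * (y - 1) := by rw [ht, hlam]
  rw [pgf_eq]
  have hc1 : Continuous (fun p : ℝ => (1 + 2 * p * (y - 1) / n) ^ m) := by fun_prop
  have hc2 : Continuous (fun p : ℝ =>
    Real.exp t * (1 + t ^ 2) + Real.exp t * t * (2 * p - 1)) := by fun_prop
  have hc3 : Continuous (fun p : ℝ => Real.exp t * t * (2 * p - 1)) := by fun_prop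
  have key : ∫ u in (0:ℝ)..1, ∫ v in (0:ℝ)..1, (1 + 2 * Pfun u v * (y - 1) / n) ^ m ≤
      ∫ u in (0:ℝ)..1, ∫ v in (0:ℝ)..1,
        (Real.exp t * (1 + t ^ 2) + Real.exp t * t * (2 * Pfun u v - 1)) := by
    apply intervalIntegral.integral_mono_on zero_le_one
      ((cont_inner _ hc1).intervalIntegrable _ _) ((cont_inner _ hc2).intervalIntegrable _ _)
    intro u hu
    apply intervalIntegral.integral_mono_on zero_le_one
      ((cont_v _ hc1 u).intervalIntegrable _ _) ((cont_v _ hc2 u).intervalIntegrable _ _)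
    intro v hv
    exact pointwise n m hn y t ht' hy hsmall u v hu hv
  have ev : ∫ u in (0:ℝ)..1, ∫ v in (0:ℝ)..1,
        (Real.exp t * (1 + t ^ 2) + Real.exp t * t * (2 * Pfun u v - 1)) =
      Real.exp t * (1 + t ^ 2) + Real.exp t * t * (1 / 12) := by
    have : ∀ u, ∫ v in (0:ℝ)..1,
        (Real.exp t * (1 + t ^ 2) + Real.exp t * t * (2 * Pfun u v - 1)) =
        Real.exp t * (1 + t ^ 2) + ∫ v in (0:ℝ)..1, Real.exp t * t * (2 * Pfun u v - 1) := by
      intro u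
      rw [intervalIntegral.integral_add (by simp) ((cont_v _ hc3 u).intervalIntegrable _ _)]
      simp
    simp only [this]
    rw [intervalIntegral.integral_add (by simp) ((cont_inner _ hc3).intervalIntegrable _ _)]
    simp only [intervalIntegral.integral_const_mul, integral_D]
    simp
  rw [ev] at key
  refine key.trans ?_
  have h4 : 13 / 12 * lam * (y - 1) + 6 / 5 * lam ^ 2 * (y - 1) ^ 2 =
      t + (t / 12 + 6 / 5 * t ^ 2) := by rw [ht]; ring
  rw [h4, Real.exp_add t]
  have h5 := Real.add_one_le_exp (t / 12 + 6 / 5 * t ^ 2)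
  have h6 : 1 + t ^ 2 + t * (1 / 12) ≤ Real.exp (t / 12 + 6 / 5 * t ^ 2) := by
    nlinarith [sq_nonneg t]
  have := mul_le_mul_of_nonneg_left h6 (Real.exp_pos t).le
  linarith
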